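/- arXiv:1712.04889 — 2 statements merged into one kernel-verified Lean document; each statement's English description precedes it below -/
import Mathlib

section
/- Let d>3/2 and δ>0. There exists a polynomial P in two variables with nonnegative coefficients, depending only on d and δ, such that for every N∈ℕ and every A∈ℂ^{N×N} of the form A=I+B with ℓ²→ℓ² operator norm ‖B‖<1, the inverse satisfies ‖A^{−1}‖_{d−1/2−δ} ≤ P(‖A‖_d, (1−‖B‖)^{−1}). -/
/-- The weighted sup-norm `‖A‖_β := sup_{i,j} |A_{ij}| (1+|i−j|)^β`. -/
noncomputable def normDecay {N : ℕ} (β : ℝ) (A : Matrix (Fin N) (Fin N) ℂ) : ℝ :=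
  Finset.fold max 0
    (fun p : Fin N × Fin N =>
      ‖A p.1 p.2‖ * (1 + |((p.1 : ℕ) : ℝ) - ((p.2 : ℕ) : ℝ)|) ^ β) Finset.univ

/-- The `ℓ²→ℓ²` operator norm of a complex `N × N` matrix. -/
noncomputable def l2OpNorm {N : ℕ} (A : Matrix (Fin N) (Fin N) ℂ) : ℝ :=
  ‖LinearMap.toContinuousLinearMap (Matrix.toEuclideanLin A)‖

open Matrix

lemma jf_coeff_mul {P Q : MvPolynomial (Fin 2) ℝ} (hP : ∀ m, 0 ≤ P.coeff m)
    (hQ : ∀ m, 0 ≤ Q.coeff m) : ∀ m, 0 ≤ (P * Q).coeff m := by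
  intro m
  rw [MvPolynomial.coeff_mul]
  exact Finset.sum_nonneg fun x _ => mul_nonneg (hP _) (hQ _)

lemma jf_coeff_add {P Q : MvPolynomial (Fin 2) ℝ} (hP : ∀ m, 0 ≤ P.coeff m)
    (hQ : ∀ m, 0 ≤ Q.coeff m) : ∀ m, 0 ≤ (P + Q).coeff m := by
  intro m
  rw [MvPolynomial.coeff_add]
  exact add_nonneg (hP _) (hQ _)

lemma jf_coeff_C {c : ℝ} (hc : 0 ≤ c) :
    ∀ m, 0 ≤ (MvPolynomial.C c : MvPolynomial (Fin 2) ℝ).coeff m := by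
  intro m
  rw [MvPolynomial.coeff_C]
  split_ifs <;> simp [hc]

lemma jf_coeff_X (i : Fin 2) :
    ∀ m, 0 ≤ (MvPolynomial.X i : MvPolynomial (Fin 2) ℝ).coeff m := by
  intro m
  classical
  rw [MvPolynomial.coeff_X]
  split_ifs <;> simp

lemma jf_coeff_pow {P : MvPolynomial (Fin 2) ℝ} (hP : ∀ m, 0 ≤ P.coeff m) (n : ℕ) :
    ∀ m, 0 ≤ (P ^ n).coeff m := by
  induction n with
  | zero => rw [pow_zero, ← MvPolynomial.C_1]; exact jf_coeff_C zero_le_one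
  | succ n ih => rw [pow_succ]; exact jf_coeff_mul ih hP

/-- distance weight -/
noncomputable def jfw {N : ℕ} (i j : Fin N) : ℝ := 1 + |((i : ℕ) : ℝ) - ((j : ℕ) : ℝ)|

lemma jfw_one_le {N : ℕ} (i j : Fin N) : 1 ≤ jfw i j := by
  unfold jfw; linarith [abs_nonneg (((i : ℕ) : ℝ) - ((j : ℕ) : ℝ))]

lemma jfw_pos {N : ℕ} (i j : Fin N) : 0 < jfw i j := by linarith [jfw_one_le i j]

lemma jf_sum (p : ℝ) (hp : 1 < p) : ∃ S : ℝ, 0 ≤ S ∧ ∀ (N : ℕ) (k : Fin N),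
    ∑ j : Fin N, (jfw j k) ^ (-p) ≤ S := by
  have h0 : Summable fun n : ℕ => (1 + (n : ℝ)) ^ (-p) := by
    have h := (summable_nat_add_iff 1).2 (Real.summable_nat_rpow.2 (by linarith : -p < -1))
    refine h.congr fun n => ?_
    push_cast
    rw [add_comm]
  have hs : Summable fun m : ℤ => (1 + |(m : ℝ)|) ^ (-p) := by
    apply Summable.of_nat_of_neg
    · refine h0.congr fun n => ?_
      simp
    · refine h0.congr fun n => ?_
      simp
  have hn : ∀ m : ℤ, 0 ≤ (1 + |(m : ℝ)|) ^ (-p) := fun m => by positivity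
  refine ⟨∑' m : ℤ, (1 + |(m : ℝ)|) ^ (-p), tsum_nonneg hn, fun N k => ?_⟩
  let e : Fin N → ℤ := fun j => ((j : ℕ) : ℤ) - ((k : ℕ) : ℤ)
  have he : Function.Injective e := by
    intro a b h
    simp only [e] at h
    ext
    omega
  have := hs.sum_le_tsum (Finset.univ.image e) (fun m _ => hn m)
  rw [Finset.sum_image (fun a _ b _ h => he h)] at this
  refine le_trans (le_of_eq ?_) this
  refine Finset.sum_congr rfl fun j _ => ?_
  simp [e, jfw]

lemma jf_entry_le {N : ℕ} (β : ℝ) (A : Matrix (Fin N) (Fin N) ℂ) (i j : Fin N) :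
    ‖A i j‖ * (jfw i j) ^ β ≤ normDecay β A := by
  unfold normDecay
  rw [Finset.le_fold_max]
  exact Or.inr ⟨(i, j), Finset.mem_univ _, le_rfl⟩

lemma jf_nonneg {N : ℕ} (β : ℝ) (A : Matrix (Fin N) (Fin N) ℂ) : 0 ≤ normDecay β A := by
  unfold normDecay
  rw [Finset.le_fold_max]
  exact Or.inl le_rfl

lemma jf_le {N : ℕ} (β : ℝ) (A : Matrix (Fin N) (Fin N) ℂ) {c : ℝ} (hc : 0 ≤ c)
    (h : ∀ i j, ‖A i j‖ * (jfw i j) ^ β ≤ c) : normDecay β A ≤ c := by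
  unfold normDecay
  rw [Finset.fold_max_le]
  exact ⟨hc, fun p _ => h p.1 p.2⟩

/-- The `ℓ²` norm. -/
noncomputable def jfn {N : ℕ} (v : Fin N → ℂ) : ℝ := ‖WithLp.toLp 2 v‖

lemma jfn_add {N : ℕ} (v u : Fin N → ℂ) : jfn (v + u) ≤ jfn v + jfn u := by
  unfold jfn; rw [WithLp.toLp_add]; exact norm_add_le _ _

lemma jfn_sub {N : ℕ} (v u : Fin N → ℂ) : jfn (v - u) ≤ jfn v + jfn u := by
  unfold jfn; rw [WithLp.toLp_sub]; exact norm_sub_le _ _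

lemma jfn_nonneg {N : ℕ} (v : Fin N → ℂ) : 0 ≤ jfn v := norm_nonneg _

lemma jfn_eq {N : ℕ} (v : Fin N → ℂ) : jfn v = √(∑ i, ‖v i‖ ^ 2) := by
  unfold jfn; rw [EuclideanSpace.norm_eq]

lemma jfn_mono {N : ℕ} {v u : Fin N → ℂ} (h : ∀ i, ‖v i‖ ≤ ‖u i‖) : jfn v ≤ jfn u := by
  rw [jfn_eq, jfn_eq]
  apply Real.sqrt_le_sqrt
  apply Finset.sum_le_sum
  intro i _
  gcongr
  exact h i

lemma jfn_smul {N : ℕ} (c : ℂ) (v : Fin N → ℂ) : jfn (c • v) = ‖c‖ * jfn v := by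
  unfold jfn; rw [WithLp.toLp_smul, norm_smul]

lemma jfn_sum {N : ℕ} (f : Fin N → Fin N → ℂ) : jfn (∑ k, f k) ≤ ∑ k, jfn (f k) := by
  unfold jfn; rw [WithLp.toLp_sum]; exact norm_sum_le _ _

lemma jf_apply_le {N : ℕ} (v : Fin N → ℂ) (i : Fin N) : ‖v i‖ ≤ jfn v := by
  exact PiLp.norm_apply_le (WithLp.toLp 2 v) i

lemma jfn_B {N : ℕ} (B : Matrix (Fin N) (Fin N) ℂ) (v : Fin N → ℂ) :
    jfn (B *ᵥ v) ≤ l2OpNorm B * jfn v := by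
  unfold jfn l2OpNorm
  exact (LinearMap.toContinuousLinearMap (Matrix.toEuclideanLin B)).le_opNorm (WithLp.toLp 2 v)

lemma jf_lower {N : ℕ} (B : Matrix (Fin N) (Fin N) ℂ) (h : l2OpNorm B < 1) (v : Fin N → ℂ) :
    jfn v ≤ (1 - l2OpNorm B)⁻¹ * jfn ((1 + B) *ᵥ v) := by
  have h1 : v = (1 + B) *ᵥ v - B *ᵥ v := by rw [Matrix.add_mulVec, Matrix.one_mulVec]; simp
  have h2 := jfn_sub ((1 + B) *ᵥ v) (B *ᵥ v)
  rw [← h1] at h2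
  have h3 := jfn_B B v
  rw [inv_mul_eq_div, le_div_iff₀ (by linarith)]
  linarith

lemma jf_unit {N : ℕ} (B : Matrix (Fin N) (Fin N) ℂ) (h : l2OpNorm B < 1) : IsUnit (1 + B) := by
  rw [← Matrix.mulVec_injective_iff_isUnit]
  intro u v huv
  have h1 := jf_lower B h (u - v)
  have h2 : (1 + B) *ᵥ (u - v) = 0 := by rw [Matrix.mulVec_sub]; exact sub_eq_zero.2 huv
  have h3 : jfn (0 : Fin N → ℂ) = 0 := by simp [jfn]
  rw [h2, h3, mul_zero] at h1
  ext i
  have := (jf_apply_le (u - v) i).trans h1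
  have h4 : (u - v) i = 0 := norm_le_zero_iff.1 this
  exact sub_eq_zero.1 h4

lemma jf_mvt {β a b : ℝ} (hβ : 1 ≤ β) (ha : 0 < a) (hb : 0 < b) (hab : b ≤ a) :
    a ^ β - b ^ β ≤ β * a ^ (β - 1) * (a - b) := by
  have h := one_add_mul_self_le_rpow_one_add (s := b / a - 1) (by
    have : 0 < b / a := by positivity
    linarith) hβ
  have e1 : 1 + (b / a - 1) = b / a := by ring
  rw [e1, Real.div_rpow hb.le ha.le, le_div_iff₀ (by positivity)] at h
  have e2 : a ^ β = a ^ (β - 1) * a := by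
    rw [Real.rpow_sub_one ha.ne']; field_simp
  have e3 : (1 + β * (b / a - 1)) * a ^ β = a ^ β + β * a ^ (β - 1) * (b - a) := by
    rw [e2]; field_simp
  rw [e3] at h
  linarith

lemma jf_diff {β a b r : ℝ} (hβ : 1 ≤ β) (ha : 1 ≤ a) (hb : 1 ≤ b) (hr : 1 + |a - b| ≤ r) :
    |a ^ β - b ^ β| ≤ β * r ^ β * b ^ (β - 1) := by
  have hr1 : 1 ≤ r := by linarith [abs_nonneg (a - b)]
  have key : ∀ c e : ℝ, 1 ≤ c → 1 ≤ e → e ≤ c → c ≤ b * r → c - e ≤ r →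
      c ^ β - e ^ β ≤ β * r ^ β * b ^ (β - 1) := by
    intro c e hc he hec hcb hce
    calc c ^ β - e ^ β ≤ β * c ^ (β - 1) * (c - e) := jf_mvt hβ (by linarith) (by linarith) hec
      _ ≤ β * (b * r) ^ (β - 1) * r := by
        gcongr
      _ = β * r ^ β * b ^ (β - 1) := by
        rw [Real.mul_rpow (by linarith) (by linarith), Real.rpow_sub_one (by linarith : r ≠ 0)]
        field_simp
  rcases le_total b a with h | h
  · rw [abs_of_nonneg (sub_nonneg.2 (Real.rpow_le_rpow (by linarith) h (by linarith)))]
    rw [abs_of_nonneg (by linarith)] at hr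
    exact key a b ha hb h (by nlinarith) (by linarith)
  · rw [abs_of_nonpos (sub_nonpos.2 (Real.rpow_le_rpow (by linarith) h (by linarith))), neg_sub]
    rw [abs_of_nonpos (by linarith)] at hr
    exact key b a hb ha h (by nlinarith) (by linarith)

lemma jf_interp {s β G w : ℝ} {n : ℕ} (hs : 0 < s) (hsβ : s < β) (hG : 1 ≤ G) (hw : 1 ≤ w)
    (hn : s / (β - s) ≤ n) : w ^ s ≤ G⁻¹ * w ^ β + G ^ n := by
  have hw0 : 0 < w := by linarith
  rcases le_total G (w ^ (β - s)) with h | h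
  · have : w ^ s ≤ G⁻¹ * w ^ β := by
      rw [inv_mul_eq_div, le_div_iff₀ (by linarith)]
      calc w ^ s * G ≤ w ^ s * w ^ (β - s) := by gcongr
        _ = w ^ β := by rw [← Real.rpow_add hw0]; congr 1; ring
    have h2 : 0 ≤ G ^ n := by positivity
    linarith
  · have : w ^ s ≤ G ^ n := by
      have hb : 0 < β - s := by linarith
      calc w ^ s = (w ^ (β - s)) ^ (s / (β - s)) := by
            rw [← Real.rpow_mul hw0.le]; congr 1; field_simp
        _ ≤ G ^ (s / (β - s)) := by gcongr
        _ ≤ G ^ (n : ℝ) := Real.rpow_le_rpow_of_exponent_le hG hn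
        _ = G ^ n := Real.rpow_natCast _ _
    have h2 : 0 ≤ G⁻¹ * w ^ β := by positivity
    linarith

lemma jfw_tri {N : ℕ} (i j k : Fin N) : 1 + |jfw j i - jfw k i| ≤ jfw j k := by
  unfold jfw
  have := abs_abs_sub_abs_le_abs_sub (((j : ℕ) : ℝ) - ((i : ℕ) : ℝ)) (((k : ℕ) : ℝ) - ((i : ℕ) : ℝ))
  have e : ∀ x y : ℝ, 1 + x - (1 + y) = x - y := fun x y => by ring
  rw [e]
  have e2 : ((j : ℕ) : ℝ) - ((i : ℕ) : ℝ) - (((k : ℕ) : ℝ) - ((i : ℕ) : ℝ))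
    = ((j : ℕ) : ℝ) - ((k : ℕ) : ℝ) := by ring
  rw [e2] at this
  linarith

/-- weighted vector -/
noncomputable def jfv {N : ℕ} (i : Fin N) (s : ℝ) (x : Fin N → ℂ) : Fin N → ℂ :=
  fun j => ((jfw j i ^ s : ℝ) : ℂ) * x j

lemma jfv_norm {N : ℕ} (i : Fin N) (s : ℝ) (x : Fin N → ℂ) (j : Fin N) :
    ‖jfv i s x j‖ = jfw j i ^ s * ‖x j‖ := by
  unfold jfv
  rw [norm_mul, Complex.norm_real, Real.norm_of_nonneg (Real.rpow_nonneg (jfw_pos _ _).le _)]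

lemma jf_col {N : ℕ} {d δ β S : ℝ} (hS : ∀ k : Fin N, ∑ j : Fin N, (jfw j k) ^ (-(1 + 2 * δ)) ≤ S)
    (hβ1 : 1 ≤ β) (hβ : β = d - 1 / 2 - δ) (A : Matrix (Fin N) (Fin N) ℂ) (i k : Fin N) :
    jfn (fun j => ((jfw j i ^ β - jfw k i ^ β : ℝ) : ℂ) * A j k)
      ≤ β * normDecay d A * jfw k i ^ (β - 1) * √S := by
  have hM := jf_nonneg d A
  have hk := jfw_pos k i
  have hc : 0 ≤ β * normDecay d A * jfw k i ^ (β - 1) := by positivity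
  rw [jfn_eq, Real.sqrt_le_left (by positivity), mul_pow,
    Real.sq_sqrt (le_trans (Finset.sum_nonneg fun j _ => Real.rpow_nonneg (jfw_pos _ _).le _) (hS k))]
  calc _ ≤ ∑ j, (β * normDecay d A * jfw k i ^ (β - 1)) ^ 2 * (jfw j k) ^ (-(1 + 2 * δ)) := by
        apply Finset.sum_le_sum
        intro j _
        have hr := jfw_pos j k
        have h1 := jf_diff hβ1 (jfw_one_le j i) (jfw_one_le k i) (jfw_tri i j k)
        have h2 := jf_entry_le d A j k
        have h3 : (jfw j k) ^ (-(1 + 2 * δ)) = (jfw j k ^ (β - d)) ^ 2 := by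
          rw [← Real.rpow_natCast, ← Real.rpow_mul hr.le]; congr 1; rw [hβ]; push_cast; ring
        rw [h3, ← mul_pow, norm_mul, Complex.norm_real, Real.norm_eq_abs]
        refine pow_le_pow_left₀ (by positivity) ?_ 2
        calc _ ≤ β * jfw j k ^ β * jfw k i ^ (β - 1) * ‖A j k‖ := by gcongr
          _ = β * jfw k i ^ (β - 1) * (jfw j k ^ (β - d)) * (‖A j k‖ * jfw j k ^ d) := by
            rw [Real.rpow_sub hr]; field_simp
          _ ≤ β * jfw k i ^ (β - 1) * (jfw j k ^ (β - d)) * normDecay d A := by gcongr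
          _ = _ := by ring
    _ ≤ _ := by
      rw [← Finset.mul_sum]
      gcongr
      exact hS k

lemma jf_cs {N : ℕ} {δ β S : ℝ} (hS : ∀ k : Fin N, ∑ j : Fin N, (jfw j k) ^ (-(1 + 2 * δ)) ≤ S)
    (i : Fin N) (x : Fin N → ℂ) :
    ∑ k, ‖x k‖ * jfw k i ^ (β - 1) ≤ √S * jfn (jfv i (β - 1 / 2 + δ) x) := by
  have h := Real.sum_mul_le_sqrt_mul_sqrt Finset.univ (fun k => jfw k i ^ (-(1 / 2 + δ)))
    (fun k => ‖jfv i (β - 1 / 2 + δ) x k‖)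
  rw [← jfn_eq] at h
  calc _ = ∑ k, jfw k i ^ (-(1 / 2 + δ)) * ‖jfv i (β - 1 / 2 + δ) x k‖ := by
        refine Finset.sum_congr rfl fun k _ => ?_
        rw [jfv_norm, ← mul_assoc, ← Real.rpow_add (jfw_pos _ _), mul_comm]
        congr 2; ring
    _ ≤ _ := h
    _ ≤ _ := by
      have := jfn_nonneg (jfv i (β - 1 / 2 + δ) x)
      gcongr
      refine le_trans (le_of_eq ?_) (hS i)
      refine Finset.sum_congr rfl fun k _ => ?_
      rw [← Real.rpow_natCast, ← Real.rpow_mul (jfw_pos _ _).le]; congr 1; push_cast; ring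

lemma jf_comm {N : ℕ} {d δ β S : ℝ} (hS0 : 0 ≤ S)
    (hS : ∀ k : Fin N, ∑ j : Fin N, (jfw j k) ^ (-(1 + 2 * δ)) ≤ S)
    (hβ1 : 1 ≤ β) (hβ : β = d - 1 / 2 - δ) (A : Matrix (Fin N) (Fin N) ℂ) (i : Fin N)
    (x : Fin N → ℂ) :
    jfn (A *ᵥ jfv i β x) ≤ jfn (jfv i β (A *ᵥ x)) +
      β * S * normDecay d A * jfn (jfv i (β - 1 / 2 + δ) x) := by
  have e : A *ᵥ jfv i β x = jfv i β (A *ᵥ x) -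
      ∑ k, x k • (fun j => ((jfw j i ^ β - jfw k i ^ β : ℝ) : ℂ) * A j k) := by
    ext j
    simp only [Pi.sub_apply, Finset.sum_apply, Pi.smul_apply, smul_eq_mul, jfv, Matrix.mulVec,
      dotProduct, Finset.mul_sum]
    rw [← Finset.sum_sub_distrib]
    refine Finset.sum_congr rfl fun k _ => ?_
    push_cast
    ring
  rw [e]
  refine (jfn_sub _ _).trans ?_
  gcongr
  have hM := jf_nonneg d A
  calc _ ≤ ∑ k, ‖x k‖ * (β * normDecay d A * jfw k i ^ (β - 1) * √S) := by
        refine (jfn_sum _).trans (Finset.sum_le_sum fun k _ => ?_)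
        rw [jfn_smul]
        gcongr
        exact jf_col hS hβ1 hβ A i k
    _ = (β * normDecay d A * √S) * ∑ k, ‖x k‖ * jfw k i ^ (β - 1) := by
        rw [Finset.mul_sum]
        refine Finset.sum_congr rfl fun k _ => ?_
        ring
    _ ≤ (β * normDecay d A * √S) * (√S * jfn (jfv i (β - 1 / 2 + δ) x)) := by
        gcongr
        exact jf_cs hS i x
    _ = β * (√S * √S) * normDecay d A * jfn (jfv i (β - 1 / 2 + δ) x) := by ring
    _ = _ := by rw [Real.mul_self_sqrt hS0]

lemma jf_main {N : ℕ} {d δ β S : ℝ} {n : ℕ} (hS0 : 0 ≤ S)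
    (hS : ∀ k : Fin N, ∑ j : Fin N, (jfw j k) ^ (-(1 + 2 * δ)) ≤ S)
    (hδ : 0 < δ) (hδ2 : δ ≤ 1 / 4)
    (hβ1 : 1 ≤ β) (hβ : β = d - 1 / 2 - δ)
    (hn : (β - 1 / 2 + δ) / (β - (β - 1 / 2 + δ)) ≤ n)
    (B : Matrix (Fin N) (Fin N) ℂ) (hB : l2OpNorm B < 1) (i j : Fin N) :
    ‖(1 + B)⁻¹ j i‖ * jfw j i ^ β ≤ 2 * (1 - l2OpNorm B)⁻¹ +
      2 * (β * S) * (1 - l2OpNorm B)⁻¹ ^ 2 * normDecay d (1 + B) *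
      (1 + 2 * (β * S) * (1 - l2OpNorm B)⁻¹ * normDecay d (1 + B)) ^ n := by
  set K := (1 - l2OpNorm B)⁻¹ with hK
  set M := normDecay d (1 + B) with hMdef
  have hM : 0 ≤ M := jf_nonneg _ _
  have hK0 : 0 ≤ K := inv_nonneg.2 (by linarith)
  set G := 1 + 2 * (β * S) * K * M with hG
  have hG1 : 1 ≤ G := by
    have : 0 ≤ 2 * (β * S) * K * M := by positivity
    linarith
  let x : Fin N → ℂ := fun k => (1 + B)⁻¹ k i
  have hx : (1 + B) *ᵥ x = Pi.single i 1 := by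
    have h1 : (1 + B) * (1 + B)⁻¹ = 1 :=
      Matrix.mul_nonsing_inv _ ((Matrix.isUnit_iff_isUnit_det _).1 (jf_unit B hB))
    ext k
    have h2 := congrFun (congrFun h1 k) i
    rw [Matrix.mul_apply] at h2
    simp only [Matrix.mulVec, dotProduct, x]
    rw [h2, Matrix.one_apply, Pi.single_apply]
  have hse : jfn (Pi.single i 1 : Fin N → ℂ) = 1 := by
    rw [jfn_eq]
    rw [Finset.sum_eq_single i]
    · simp
    · intro b _ hb; simp [hb]
    · simp
  have hwe : jfv i β (Pi.single i 1) = Pi.single i 1 := by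
    ext k
    unfold jfv
    by_cases h : k = i
    · subst h; simp [jfw]
    · simp [h]
  have hxK : jfn x ≤ K := by
    have := jf_lower B hB x
    rwa [hx, hse, mul_one] at this
  have h1 := jf_lower B hB (jfv i β x)
  have h2 := jf_comm hS0 hS hβ1 hβ (1 + B) i x
  rw [hx, hwe, hse, ← hMdef] at h2
  have h3 : jfn (jfv i (β - 1 / 2 + δ) x) ≤ G⁻¹ * jfn (jfv i β x) + G ^ n * jfn x := by
    have e1 : G⁻¹ * jfn (jfv i β x) = jfn (((G⁻¹ : ℝ) : ℂ) • jfv i β x) := by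
      rw [jfn_smul, Complex.norm_real, Real.norm_of_nonneg (by positivity)]
    have e2 : G ^ n * jfn x = jfn (((G ^ n : ℝ) : ℂ) • x) := by
      rw [jfn_smul, Complex.norm_real, Real.norm_of_nonneg (by positivity)]
    have e3 : jfn (fun k => ((G⁻¹ * jfw k i ^ β + G ^ n : ℝ) : ℂ) * x k) ≤
        jfn (((G⁻¹ : ℝ) : ℂ) • jfv i β x) + jfn (((G ^ n : ℝ) : ℂ) • x) := by
      refine le_trans (le_of_eq ?_) (jfn_add _ _)
      congr 1
      ext k
      simp only [Pi.add_apply, Pi.smul_apply, smul_eq_mul, jfv]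
      push_cast
      ring
    rw [e1, e2]
    refine le_trans (jfn_mono fun k => ?_) e3
    have := jfw_pos k i
    rw [jfv_norm, norm_mul, Complex.norm_real, Real.norm_of_nonneg (by positivity)]
    gcongr
    exact jf_interp (by linarith) (by linarith) hG1 (jfw_one_le k i) hn
  set Y := jfn (jfv i β x) with hY
  have hY0 : 0 ≤ Y := jfn_nonneg _
  have hG0 : 0 < G := by linarith
  have h4 : Y ≤ K * (1 + β * S * M * (G⁻¹ * Y + G ^ n * K)) := by
    refine h1.trans ?_
    gcongr
    refine h2.trans ?_
    gcongr
    refine h3.trans ?_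
    gcongr
  have h5 : K * (β * S) * M * G⁻¹ ≤ 1 / 2 := by
    rw [← div_eq_mul_inv, div_le_iff₀ hG0]
    linarith
  have h6 := mul_le_mul_of_nonneg_right h5 hY0
  have h7 : K * (1 + β * S * M * (G⁻¹ * Y + G ^ n * K)) =
    K + K * (β * S) * M * G⁻¹ * Y + (β * S) * K ^ 2 * M * G ^ n := by ring
  have h8 := jf_apply_le (jfv i β x) j
  rw [jfv_norm] at h8
  calc _ = jfw j i ^ β * ‖x j‖ := mul_comm _ _
    _ ≤ Y := h8
    _ ≤ _ := by linarith

theorem inverse_norm_decay_of_decay (d δ : ℝ) (hd : 3 / 2 < d) (hδ : 0 < δ) :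
    ∃ P : MvPolynomial (Fin 2) ℝ, (∀ m, 0 ≤ P.coeff m) ∧
      ∀ (N : ℕ) (B : Matrix (Fin N) (Fin N) ℂ), l2OpNorm B < 1 →
        normDecay (d - 1 / 2 - δ) (1 + B)⁻¹ ≤
          MvPolynomial.eval (![normDecay d (1 + B), (1 - l2OpNorm B)⁻¹]) P := by
  obtain ⟨ε, hε, hε1, hε2, hε3⟩ : ∃ ε : ℝ, 0 < ε ∧ ε ≤ δ ∧ ε ≤ 1 / 4 ∧ ε ≤ d - 3 / 2 :=
    ⟨min δ (min (1 / 4) (d - 3 / 2)), by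
      refine lt_min hδ (lt_min (by norm_num) (by linarith)), min_le_left _ _,
      (min_le_right _ _).trans (min_le_left _ _), (min_le_right _ _).trans (min_le_right _ _)⟩
  obtain ⟨S, hS0, hS⟩ := jf_sum (1 + 2 * ε) (by linarith)
  obtain ⟨β, hβ⟩ : ∃ β : ℝ, β = d - 1 / 2 - ε := ⟨_, rfl⟩
  have hβ1 : 1 ≤ β := by linarith
  obtain ⟨n, hn⟩ := exists_nat_ge ((β - 1 / 2 + ε) / (β - (β - 1 / 2 + ε)))
  have hc : 0 ≤ 2 * (β * S) := by positivity
  have h2 : (0 : ℝ) ≤ 2 := by norm_num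
  refine ⟨MvPolynomial.C 2 * MvPolynomial.X 1 +
    MvPolynomial.C (2 * (β * S)) * MvPolynomial.X 1 ^ 2 * MvPolynomial.X 0 *
    (MvPolynomial.C 1 + MvPolynomial.C (2 * (β * S)) * MvPolynomial.X 1 * MvPolynomial.X 0) ^ n,
    ?_, ?_⟩
  · exact jf_coeff_add (jf_coeff_mul (jf_coeff_C h2) (jf_coeff_X 1))
      (jf_coeff_mul (jf_coeff_mul (jf_coeff_mul (jf_coeff_C hc) (jf_coeff_pow (jf_coeff_X 1) 2))
        (jf_coeff_X 0)) (jf_coeff_pow (jf_coeff_add (jf_coeff_C zero_le_one)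
          (jf_coeff_mul (jf_coeff_mul (jf_coeff_C hc) (jf_coeff_X 1)) (jf_coeff_X 0))) n))
  · intro N B hB
    have hM := jf_nonneg d (1 + B)
    have hK : 0 ≤ (1 - l2OpNorm B)⁻¹ := inv_nonneg.2 (by linarith)
    simp only [map_add, map_mul, map_pow, MvPolynomial.eval_C, MvPolynomial.eval_X,
      Matrix.cons_val_zero, Matrix.cons_val_one]
    refine jf_le _ _ (by positivity) fun i j => ?_
    refine le_trans ?_ (jf_main hS0 (hS N) hε hε2 hβ1 hβ hn B hB j i)
    gcongr
    · exact jfw_one_le i j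
    · linarith
end

section
/- Let d>2, α∈(2,d), c₁>0, c>0. Let N∈ℕ and let ξ:(ℤ/N)⁴→ℝ satisfy, with |·| the circular distance on ℤ/N, both |ξ(p,α',β,q)| ≤ c₁² max{(|p−β|+|α'−q|+1)^{−d}, (|p−q|+|α'−β|+1)^{−d}} and |ξ(p,α',β,q)| ≤ c₁²(1+|p−q|)^{−d} for all indices, and define S(M)_{pq} := N^{−1}Σ_{α',β} ξ(p,α',β,q) M_{α'β}. Suppose z∈ℂ and M∈ℂ^{N×N} is invertible, satisfies M·(−z·I − S(M)) = I, and ‖M‖ ≤ c and ‖M^{−1}‖ ≤ c (ℓ²→ℓ² operator norms). Then there is a constant C depending only on c, α, d, c₁ (and not on N, z or M) such that ‖M‖_α ≤ C. -/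
/-- Circular distance on `ℤ/N` (represented by `Fin N`). -/
def cdist {N : ℕ} (i j : Fin N) : ℕ :=
  min ((i : ℤ) - (j : ℤ)).natAbs (N - ((i : ℤ) - (j : ℤ)).natAbs)

/-- The weighted sup-norm `‖A‖_β := sup_{i,j} |A_{ij}| (1+|i−j|)^β`, with circular distance. -/
noncomputable def normDecayCirc {N : ℕ} (β : ℝ) (A : Matrix (Fin N) (Fin N) ℂ) : ℝ :=
  Finset.fold max 0
    (fun p : Fin N × Fin N => ‖A p.1 p.2‖ * (1 + (cdist p.1 p.2 : ℝ)) ^ β) Finset.univ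

/-- The map `S(M)_{pq} := N^{−1} Σ_{α,β} ξ(p,α,β,q) M_{αβ}`. -/
noncomputable def SmapXi {N : ℕ} (ξ : Fin N → Fin N → Fin N → Fin N → ℝ)
    (M : Matrix (Fin N) (Fin N) ℂ) : Matrix (Fin N) (Fin N) ℂ :=
  Matrix.of fun p q => (N : ℂ)⁻¹ * ∑ a, ∑ b, (ξ p a b q : ℂ) * M a b

theorem cdist_symm' {N : ℕ} (i j : Fin N) : cdist i j = cdist j i := by
  unfold cdist; omega

theorem cdist_tri {N : ℕ} (i j k : Fin N) : cdist i k ≤ cdist i j + cdist j k := by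
  unfold cdist; omega

theorem cdist_self' {N : ℕ} (i : Fin N) : cdist i i = 0 := by
  unfold cdist; omega

theorem cdist_lt {N : ℕ} (i j : Fin N) : cdist i j + 1 ≤ N := by
  unfold cdist; omega

theorem cdist_eq {N : ℕ} [NeZero N] (i j : Fin N) :
    cdist i j = (i - j).val ∨ cdist i j = (j - i).val := by
  have h1 := i.2
  have h2 := j.2
  rcases lt_trichotomy i j with h | h | h
  · have e1 := Fin.sub_val_of_le h.le
    have e2 := Fin.val_sub i j
    have h' : i.val < j.val := h
    rw [Nat.mod_eq_of_lt (by omega)] at e2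
    unfold cdist; omega
  · subst h
    left; rw [cdist_self']; simp
  · have e1 := Fin.sub_val_of_le h.le
    have e2 := Fin.val_sub j i
    have h' : j.val < i.val := h
    rw [Nat.mod_eq_of_lt (by omega)] at e2
    unfold cdist; omega

theorem sum_bound (η : ℝ) (hη : 1 < η) : ∃ G : ℝ, 0 < G ∧ ∀ (N : ℕ) (x : Fin N),
    ∑ y, (1 + (cdist x y : ℝ)) ^ (-η) ≤ G := by
  have hs : Summable (fun n : ℕ => (1 + (n : ℝ)) ^ (-η)) := by
    have h := (summable_nat_add_iff 1).2 (Real.summable_nat_rpow.2 (by linarith : -η < -1))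
    refine h.congr fun n => ?_
    push_cast; rw [add_comm]
  have hnn : ∀ n : ℕ, 0 ≤ (1 + (n : ℝ)) ^ (-η) := fun n => by positivity
  refine ⟨2 * (∑' n : ℕ, (1 + (n : ℝ)) ^ (-η)) + 1, ?_, ?_⟩
  · have : 0 ≤ ∑' n : ℕ, (1 + (n : ℝ)) ^ (-η) := tsum_nonneg hnn
    linarith
  intro N x
  have : NeZero N := ⟨by have := x.2; omega⟩
  have hk : ∑ k : Fin N, (1 + ((k : ℕ) : ℝ)) ^ (-η) ≤ ∑' n : ℕ, (1 + (n : ℝ)) ^ (-η) := by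
    rw [Fin.sum_univ_eq_sum_range (fun n : ℕ => (1 + (n : ℝ)) ^ (-η)) N]
    exact hs.sum_le_tsum _ (fun n _ => hnn n)
  have e1 : ∑ y : Fin N, (1 + (((x - y : Fin N) : ℕ) : ℝ)) ^ (-η)
      = ∑ k : Fin N, (1 + ((k : ℕ) : ℝ)) ^ (-η) :=
    Equiv.sum_comp (Equiv.subLeft x) (fun k : Fin N => (1 + ((k : ℕ) : ℝ)) ^ (-η))
  have e2 : ∑ y : Fin N, (1 + (((y - x : Fin N) : ℕ) : ℝ)) ^ (-η)
      = ∑ k : Fin N, (1 + ((k : ℕ) : ℝ)) ^ (-η) :=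
    Equiv.sum_comp (Equiv.subRight x) (fun k : Fin N => (1 + ((k : ℕ) : ℝ)) ^ (-η))
  have : ∑ y, (1 + (cdist x y : ℝ)) ^ (-η) ≤
      ∑ y : Fin N, ((1 + (((x - y : Fin N) : ℕ) : ℝ)) ^ (-η)
        + (1 + (((y - x : Fin N) : ℕ) : ℝ)) ^ (-η)) := by
    refine Finset.sum_le_sum fun y _ => ?_
    have a1 := hnn (x - y : Fin N)
    have a2 := hnn (y - x : Fin N)
    rcases cdist_eq x y with h | h <;> rw [h] <;> linarith
  rw [Finset.sum_add_distrib, e1, e2] at this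
  linarith

theorem xi_bound (d θ ε D s m pb aq X k : ℝ) (hθ : 0 ≤ θ) (hε : 0 < ε) (hd : 1 + ε + θ ≤ d)
    (hD : 0 ≤ D) (hm : 0 ≤ m) (hpb : 0 ≤ pb) (haq : 0 ≤ aq) (hs : s = pb + aq) (hk : 0 ≤ k)
    (h1 : X ≤ k * max ((s + 1) ^ (-d)) ((D + m + 1) ^ (-d)))
    (h2 : X ≤ k * (1 + D) ^ (-d)) :
    X ≤ k * ((1 + D) ^ (-(d - θ - ε) + 1) * ((1 + pb) ^ (-(1 + ε)) * (1 + aq) ^ (-θ))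
      + (1 + D) ^ (-(d - θ - ε)) * (1 + m) ^ (-θ)) := by
  have anti : ∀ x y e : ℝ, 0 ≤ x → x ≤ y → 0 ≤ e → (1 + y) ^ (-e) ≤ (1 + x) ^ (-e) := by
    intro x y e hx hxy he
    exact Real.rpow_le_rpow_of_nonpos (by linarith) (by linarith) (by linarith)
  have split : ∀ x : ℝ, 0 ≤ x → ∀ e1 e2 : ℝ, (1 + x) ^ (e1 + e2) = (1 + x) ^ e1 * (1 + x) ^ e2 :=
    fun x hx e1 e2 => Real.rpow_add (by linarith) _ _
  have hs0 : 0 ≤ s := by linarith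
  have n1 : 0 ≤ (1 + D) ^ (-(d - θ - ε) + 1) * ((1 + pb) ^ (-(1 + ε)) * (1 + aq) ^ (-θ)) := by
    positivity
  have n2 : 0 ≤ (1 + D) ^ (-(d - θ - ε)) * (1 + m) ^ (-θ) := by positivity
  have key : ∀ u : ℝ, D ≤ u → s ≤ u → (1 + u) ^ (-d) ≤
      (1 + D) ^ (-(d - θ - ε) + 1) * ((1 + pb) ^ (-(1 + ε)) * (1 + aq) ^ (-θ)) := by
    intro u hu1 hu2
    have hu : 0 ≤ u := by linarith
    rw [show -d = -(d - θ - ε - 1) + (-(1 + ε) + -θ) by ring, split u hu, split u hu,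
      show -(d - θ - ε) + 1 = -(d - θ - ε - 1) by ring]
    gcongr ?_ * (?_ * ?_)
    · exact anti _ _ _ hD hu1 (by linarith)
    · exact anti _ _ _ hpb (by linarith) (by linarith)
    · exact anti _ _ _ haq (by linarith) (by linarith)
  have key2 : (D + m + 1) ^ (-d) ≤ (1 + D) ^ (-(d - θ - ε)) * (1 + m) ^ (-θ) := by
    rw [show D + m + 1 = 1 + (D + m) by ring]
    calc (1 + (D + m)) ^ (-d) ≤ (1 + (D + m)) ^ (-(d - θ - ε) + -θ) := by
          apply Real.rpow_le_rpow_of_exponent_le <;> linarith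
      _ = _ := split _ (by linarith) _ _
      _ ≤ _ := by
          gcongr ?_ * ?_
          · exact anti _ _ _ hD (by linarith) (by linarith)
          · exact anti _ _ _ hm (by linarith) (by linarith)
  rcases max_cases ((s + 1) ^ (-d)) ((D + m + 1) ^ (-d)) with ⟨h, -⟩ | ⟨h, -⟩
  · rw [h] at h1
    rcases le_total D s with hh | hh
    · refine h1.trans (mul_le_mul_of_nonneg_left ?_ hk)
      have := key s hh le_rfl
      rw [add_comm s 1]; linarith
    · refine h2.trans (mul_le_mul_of_nonneg_left ?_ hk)
      have := key D le_rfl hh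
      linarith
  · rw [h] at h1
    refine h1.trans (mul_le_mul_of_nonneg_left ?_ hk)
    linarith

theorem S_decay (d θ ε c₁ K : ℝ) (hθ : 0 ≤ θ) (hε : 0 < ε) (hd : 1 + ε + θ ≤ d) (hK : 0 ≤ K) :
    ∃ C : ℝ, 0 ≤ C ∧ ∀ (N : ℕ) (ξ : Fin N → Fin N → Fin N → Fin N → ℝ),
      (∀ p a b q : Fin N, |ξ p a b q| ≤
        c₁ ^ 2 * max (((cdist p b : ℝ) + (cdist a q : ℝ) + 1) ^ (-d))
          (((cdist p q : ℝ) + (cdist a b : ℝ) + 1) ^ (-d))) →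
      (∀ p a b q : Fin N, |ξ p a b q| ≤ c₁ ^ 2 * (1 + (cdist p q : ℝ)) ^ (-d)) →
      ∀ M : Matrix (Fin N) (Fin N) ℂ,
      (∀ q b, ∑ a, (1 + (cdist a q : ℝ)) ^ (-θ) * ‖M a b‖ ≤ K) →
      ∀ p q, ‖SmapXi ξ M p q‖ ≤ C * (1 + (cdist p q : ℝ)) ^ (-(d - θ - ε)) := by
  obtain ⟨G, hG, hGs⟩ := sum_bound (1 + ε) (by linarith)
  refine ⟨c₁ ^ 2 * (G * K + K), by positivity, ?_⟩
  intro N ξ h1 h2 M hM p q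
  have hN : 0 < (N : ℝ) := by
    have := p.2
    exact_mod_cast (by omega : 0 < N)
  set D : ℝ := (cdist p q : ℝ) with hD
  have hD0 : 0 ≤ D := by positivity
  have hDN : 1 + D ≤ N := by
    have := cdist_lt p q
    rw [hD]; exact_mod_cast (by omega : 1 + cdist p q ≤ N)
  set P := (1 + D) ^ (-(d - θ - ε)) with hP
  have hP0 : 0 ≤ P := by positivity
  have hP1 : (1 + D) ^ (-(d - θ - ε) + 1) = P * (1 + D) := by
    rw [Real.rpow_add (by linarith), Real.rpow_one]
  have step : ∀ a b, |ξ p a b q| ≤ c₁ ^ 2 * ((P * (1 + D)) * ((1 + (cdist p b : ℝ)) ^ (-(1 + ε))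
      * (1 + (cdist a q : ℝ)) ^ (-θ)) + P * (1 + (cdist a b : ℝ)) ^ (-θ)) := by
    intro a b
    rw [← hP1]
    exact xi_bound d θ ε D _ _ _ _ _ _ hθ hε hd hD0 (by positivity) (by positivity) (by positivity)
      rfl (by positivity) (h1 p a b q) (h2 p a b q)
  have e : ‖SmapXi ξ M p q‖ ≤ (N : ℝ)⁻¹ * ∑ b, ∑ a, |ξ p a b q| * ‖M a b‖ := by
    rw [Finset.sum_comm]
    simp only [SmapXi, Matrix.of_apply, norm_mul, norm_inv, Complex.norm_natCast]
    gcongr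
    refine (norm_sum_le _ _).trans (Finset.sum_le_sum fun a _ => ?_)
    refine (norm_sum_le _ _).trans (Finset.sum_le_sum fun b _ => ?_)
    rw [norm_mul, Complex.norm_real, Real.norm_eq_abs]
  have inner : ∀ b, ∑ a, |ξ p a b q| * ‖M a b‖ ≤
      c₁ ^ 2 * (P * (1 + D) * K * (1 + (cdist p b : ℝ)) ^ (-(1 + ε)) + P * K) := by
    intro b
    calc ∑ a, |ξ p a b q| * ‖M a b‖ ≤ ∑ a, (c₁ ^ 2 * ((P * (1 + D)) *
          ((1 + (cdist p b : ℝ)) ^ (-(1 + ε))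
          * (1 + (cdist a q : ℝ)) ^ (-θ)) + P * (1 + (cdist a b : ℝ)) ^ (-θ))) * ‖M a b‖ := by
          gcongr with a
          exact step a b
      _ = c₁ ^ 2 * (P * (1 + D) * (1 + (cdist p b : ℝ)) ^ (-(1 + ε)) *
            (∑ a, (1 + (cdist a q : ℝ)) ^ (-θ) * ‖M a b‖)
            + P * ∑ a, (1 + (cdist a b : ℝ)) ^ (-θ) * ‖M a b‖) := by
          rw [Finset.mul_sum, Finset.mul_sum, ← Finset.sum_add_distrib, Finset.mul_sum]
          refine Finset.sum_congr rfl fun a _ => by ring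
      _ ≤ c₁ ^ 2 * (P * (1 + D) * (1 + (cdist p b : ℝ)) ^ (-(1 + ε)) * K + P * K) := by
          gcongr
          · exact hM q b
          · exact hM b b
      _ = _ := by ring
  calc ‖SmapXi ξ M p q‖ ≤ (N : ℝ)⁻¹ * ∑ b, ∑ a, |ξ p a b q| * ‖M a b‖ := e
    _ ≤ (N : ℝ)⁻¹ * ∑ b : Fin N,
        c₁ ^ 2 * (P * (1 + D) * K * (1 + (cdist p b : ℝ)) ^ (-(1 + ε)) + P * K) := by
        gcongr with b
        exact inner b
    _ = (N : ℝ)⁻¹ * (c₁ ^ 2 * (P * (1 + D) * K * (∑ b, (1 + (cdist p b : ℝ)) ^ (-(1 + ε)))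
        + N * (P * K))) := by
        rw [← Finset.mul_sum, Finset.sum_add_distrib, ← Finset.mul_sum]
        simp
    _ ≤ (N : ℝ)⁻¹ * (c₁ ^ 2 * (P * N * K * G + N * (P * K))) := by
        have hb : P * (1 + D) * K * (∑ b, (1 + (cdist p b : ℝ)) ^ (-(1 + ε)))
            ≤ P * N * K * G :=
          mul_le_mul (mul_le_mul_of_nonneg_right (mul_le_mul_of_nonneg_left hDN hP0) hK)
            (hGs N p) (Finset.sum_nonneg fun b _ => by positivity) (by positivity)
        exact mul_le_mul_of_nonneg_left (mul_le_mul_of_nonneg_left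
          (add_le_add_left hb _) (sq_nonneg _)) (by positivity)
    _ = ((N : ℝ)⁻¹ * N) * (c₁ ^ 2 * (G * K + K) * P) := by ring
    _ = c₁ ^ 2 * (G * K + K) * P := by rw [inv_mul_cancel₀ hN.ne', one_mul]

open scoped Matrix.Norms.L2Operator in
theorem l2_eq {N : ℕ} (A : Matrix (Fin N) (Fin N) ℂ) : l2OpNorm A = ‖A‖ := rfl

open scoped Matrix.Norms.L2Operator in
theorem l2_conj {N : ℕ} (A : Matrix (Fin N) (Fin N) ℂ) :
    l2OpNorm (A.conjTranspose) = l2OpNorm A := by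
  rw [l2_eq, l2_eq, Matrix.l2_opNorm_conjTranspose]

theorem mulVec_bound {N : ℕ} (A : Matrix (Fin N) (Fin N) ℂ) (c : ℝ) (h : l2OpNorm A ≤ c)
    (v : Fin N → ℂ) : ∑ x, ‖(A.mulVec v) x‖ ^ 2 ≤ c ^ 2 * ∑ x, ‖v x‖ ^ 2 := by
  have h1 := ContinuousLinearMap.le_opNorm
    (LinearMap.toContinuousLinearMap (Matrix.toEuclideanLin A)) (WithLp.toLp 2 v)
  have h2 : ‖LinearMap.toContinuousLinearMap (Matrix.toEuclideanLin A) (WithLp.toLp 2 v)‖ ≤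
      c * ‖WithLp.toLp 2 v‖ := h1.trans (mul_le_mul_of_nonneg_right h (norm_nonneg _))
  have h3 := pow_le_pow_left₀ (norm_nonneg _) h2 2
  rw [mul_pow, EuclideanSpace.norm_sq_eq, EuclideanSpace.norm_sq_eq] at h3
  exact h3

theorem col_bound {N : ℕ} (A : Matrix (Fin N) (Fin N) ℂ) (c : ℝ) (h : l2OpNorm A ≤ c)
    (b : Fin N) : ∑ a, ‖A a b‖ ^ 2 ≤ c ^ 2 := by
  have := mulVec_bound A c h (Pi.single b 1)
  simp only [Matrix.mulVec_single_one, Matrix.col_apply] at this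
  refine this.trans_eq ?_
  rw [Finset.sum_eq_single b] <;> simp +contextual

/-- The commutator identity `f u = M [A, f] u` for a column `u` of `M` at `j`, `f j = 0`. -/
theorem comm_id {N : ℕ} (M A : Matrix (Fin N) (Fin N) ℂ) (hMA : M * A = 1) (j : Fin N)
    (f : Fin N → ℝ) (hf : f j = 0) :
    M.mulVec (fun x => ∑ y, A x y * ((f y : ℂ) - f x) * M y j) = fun x => (f x : ℂ) * M x j := by
  have hAM : A * M = 1 := mul_eq_one_comm.1 hMA
  have e : (fun x => ∑ y, A x y * ((f y : ℂ) - f x) * M y j)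
      = A.mulVec (fun x => (f x : ℂ) * M x j) := by
    funext x
    have h := congrFun (congrFun hAM x) j
    rw [Matrix.mul_apply] at h
    have h0 : (f x : ℂ) * ∑ y, A x y * M y j = 0 := by
      rw [h]
      by_cases hx : x = j
      · subst hx; simp [hf]
      · simp [hx]
    have : ∑ y, A x y * ((f y : ℂ) - f x) * M y j =
        ∑ y, A x y * ((f y : ℂ) * M y j) - (f x : ℂ) * ∑ y, A x y * M y j := by
      rw [Finset.mul_sum, ← Finset.sum_sub_distrib]
      exact Finset.sum_congr rfl fun y _ => by ring
    rw [this, h0, sub_zero]; rfl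
  rw [e, Matrix.mulVec_mulVec, hMA, Matrix.one_mulVec]

theorem rpow_diff_small (τ a b t : ℝ) (h0 : 0 < τ) (h1 : τ ≤ 1) (ha : 0 ≤ a) (hb : 0 ≤ b)
    (ht : 0 ≤ t) (hab : a ≤ b + t) (hba : b ≤ a + t) : |a ^ τ - b ^ τ| ≤ t ^ τ := by
  have e1 := (Real.rpow_le_rpow ha hab h0.le).trans (Real.rpow_add_le_add_rpow hb ht h0.le h1)
  have e2 := (Real.rpow_le_rpow hb hba h0.le).trans (Real.rpow_add_le_add_rpow ha ht h0.le h1)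
  rw [abs_le]; constructor <;> linarith

theorem rpow_diff_big (α a b t : ℝ) (h1 : 1 ≤ α) (ha : 0 ≤ a) (hb : 0 ≤ b)
    (ht : 0 ≤ t) (hab : a ≤ b + t) (hba : b ≤ a + t) :
    |a ^ α - b ^ α| ≤ α * 2 ^ (α - 1) * (t * b ^ (α - 1) + t * t ^ (α - 1)) := by
  -- mean value type bound
  have mv : ∀ x y : ℝ, 0 ≤ x → x ≤ y → y ≤ x + t → y ^ α - x ^ α ≤ α * t * y ^ (α - 1) := by
    intro x y hx hxy hyt
    rcases eq_or_lt_of_le (hx.trans hxy) with hy | hy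
    · have : x = 0 := by linarith
      subst this; subst hy
      rw [sub_self]; positivity
    have hB := one_add_mul_self_le_rpow_one_add (s := x / y - 1) (p := α)
      (by have : 0 ≤ x / y := by positivity
          linarith) h1
    rw [show 1 + (x / y - 1) = x / y by ring, Real.div_rpow hx hy.le, le_div_iff₀ (by positivity)]
      at hB
    have hyy : y ^ α = y ^ (α - 1) * y := by
      rw [← Real.rpow_add_one hy.ne']; congr 1; ring
    have : (1 + α * (x / y - 1)) * y ^ α = y ^ α + α * (x - y) * y ^ (α - 1) := by
      rw [hyy]; field_simp
    rw [this] at hB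
    have : α * (y - x) * y ^ (α - 1) ≤ α * t * y ^ (α - 1) := by
      gcongr; linarith
    linarith
  have mx : ∀ y : ℝ, 0 ≤ y → y ≤ b + t → α * t * y ^ (α - 1) ≤
      α * 2 ^ (α - 1) * (t * b ^ (α - 1) + t * t ^ (α - 1)) := by
    intro y hy hyb
    have h2 : y ^ (α - 1) ≤ 2 ^ (α - 1) * (b ^ (α - 1) + t ^ (α - 1)) := by
      calc y ^ (α - 1) ≤ (2 * max b t) ^ (α - 1) := by
            apply Real.rpow_le_rpow hy _ (by linarith)
            have := le_max_left b t
            have := le_max_right b t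
            linarith
        _ = 2 ^ (α - 1) * (max b t) ^ (α - 1) := Real.mul_rpow (by norm_num) (le_max_of_le_left hb)
        _ ≤ _ := by
            gcongr
            have : 0 ≤ b ^ (α - 1) := by positivity
            have : 0 ≤ t ^ (α - 1) := by positivity
            rcases max_cases b t with ⟨h, -⟩ | ⟨h, -⟩ <;> rw [h] <;> linarith
    calc α * t * y ^ (α - 1) ≤ α * t * (2 ^ (α - 1) * (b ^ (α - 1) + t ^ (α - 1))) := by gcongr
      _ = _ := by ring
  rcases le_total a b with h | h
  · rw [abs_sub_comm, abs_of_nonneg (sub_nonneg.2 (Real.rpow_le_rpow ha h (by linarith)))]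
    exact (mv a b ha h hba).trans (mx b hb (by linarith))
  · rw [abs_of_nonneg (sub_nonneg.2 (Real.rpow_le_rpow hb h (by linarith)))]
    exact (mv b a hb h hab).trans (mx a ha hab)

theorem young_pow (α b e : ℝ) (h1 : 1 < α) (hb : 0 ≤ b) (he : 0 < e) :
    b ^ (α - 1) ≤ e * b ^ α + (e⁻¹) ^ (α - 1) := by
  rcases le_total b e⁻¹ with h | h
  · have := Real.rpow_le_rpow hb h (by linarith : 0 ≤ α - 1)
    have : 0 ≤ e * b ^ α := by positivity
    linarith
  · have hb' : 0 < b := lt_of_lt_of_le (by positivity) h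
    have e1 : b ^ α = b ^ (α - 1) * b := by
      rw [← Real.rpow_add_one hb'.ne']; congr 1; ring
    have e2 : 1 ≤ e * b := by
      rw [inv_le_iff_one_le_mul₀' he] at h; linarith
    have e3 : 0 ≤ b ^ (α - 1) := by positivity
    have e4 : 0 ≤ (e⁻¹) ^ (α - 1) := by positivity
    rw [e1]; nlinarith

/-- One plus a nonnegative number, monotonicity for products of powers. -/
theorem pow_mul_le (t σ e : ℝ) (ht : 0 ≤ t) (hσ : 0 ≤ σ) :
    (1 + t) ^ (-e) * t ^ σ ≤ (1 + t) ^ (-(e - σ)) := by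
  rw [show -(e - σ) = -e + σ by ring, Real.rpow_add (by linarith)]
  gcongr
  linarith

theorem step_one (c K s : ℝ) (hK : 0 ≤ K) (hs : 3 / 2 < s) :
    ∃ R : ℝ, 0 ≤ R ∧ ∀ (N : ℕ) (M A : Matrix (Fin N) (Fin N) ℂ), M * A = 1 → l2OpNorm M ≤ c →
      (∀ x y, x ≠ y → ‖A x y‖ ≤ K * (1 + (cdist x y : ℝ)) ^ (-s)) →
      ∀ j, ∑ x, ‖M x j‖ ≤ R := by
  obtain ⟨τ, hτ1, hτ2, hτ3⟩ : ∃ τ : ℝ, 1 / 2 < τ ∧ τ ≤ 1 ∧ 1 < s - τ := by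
    refine ⟨min 1 ((s - 1 / 2) / 2), lt_min (by norm_num) (by linarith), min_le_left _ _, ?_⟩
    have := min_le_right 1 ((s - 1 / 2) / 2)
    linarith
  obtain ⟨G, hG, hGs⟩ := sum_bound (s - τ) hτ3
  obtain ⟨G', hG', hGs'⟩ := sum_bound (2 * τ) (by linarith)
  refine ⟨G' + 2 * c ^ 2 + 2 * (c ^ 2 * ((K * G) * ((K * G) * c ^ 2))), by positivity, ?_⟩
  intro N M A hMA hM hA j
  set f : Fin N → ℝ := fun x => (cdist x j : ℝ) ^ τ with hf
  have hfj : f j = 0 := by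
    simp only [hf, cdist_self']
    rw [Nat.cast_zero, Real.zero_rpow (by linarith)]
  have hid := comm_id M A hMA j f hfj
  set w : Fin N → ℂ := fun x => ∑ y, A x y * ((f y : ℂ) - f x) * M y j with hw
  set κ : Fin N → Fin N → ℝ := fun x y => K * (1 + (cdist x y : ℝ)) ^ (-(s - τ)) with hκ
  have hκ0 : ∀ x y, 0 ≤ κ x y := fun x y => by simp only [hκ]; positivity
  have hκs : ∀ x, ∑ y, κ x y ≤ K * G := by
    intro x
    simp only [hκ, ← Finset.mul_sum]
    exact mul_le_mul_of_nonneg_left (hGs N x) hK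
  have hκs' : ∀ y, ∑ x, κ x y ≤ K * G := by
    intro y
    refine le_trans (le_of_eq ?_) (hκs y)
    refine Finset.sum_congr rfl fun x _ => ?_
    simp only [hκ, cdist_symm' x y]
  have hu : ∑ x, ‖M x j‖ ^ 2 ≤ c ^ 2 := col_bound M c hM j
  have hent : ∀ x y, ‖A x y * ((f y : ℂ) - f x)‖ ≤ κ x y := by
    intro x y
    by_cases hxy : x = y
    · subst hxy; simpa using hκ0 x x
    rw [norm_mul, ← Complex.ofReal_sub, Complex.norm_real, Real.norm_eq_abs]
    have e1 : |f y - f x| ≤ (cdist x y : ℝ) ^ τ := by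
      refine rpow_diff_small τ _ _ _ (by linarith) hτ2 (by positivity) (by positivity)
        (by positivity) ?_ ?_
      · have := cdist_tri y x j
        rw [cdist_symm' y x] at this
        exact_mod_cast (by omega : cdist y j ≤ cdist x j + cdist x y)
      · have := cdist_tri x y j
        exact_mod_cast (by omega : cdist x j ≤ cdist y j + cdist x y)
    calc ‖A x y‖ * |f y - f x| ≤ (K * (1 + (cdist x y : ℝ)) ^ (-s)) * (cdist x y : ℝ) ^ τ :=
          mul_le_mul (hA x y hxy) e1 (abs_nonneg _) (by positivity)
      _ = K * ((1 + (cdist x y : ℝ)) ^ (-s) * (cdist x y : ℝ) ^ τ) := by ring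
      _ ≤ κ x y := mul_le_mul_of_nonneg_left
          (pow_mul_le _ _ _ (by positivity) (by linarith)) hK
  have hwx : ∀ x, ‖w x‖ ^ 2 ≤ (K * G) * ∑ y, κ x y * ‖M y j‖ ^ 2 := by
    intro x
    have e1 : ‖w x‖ ≤ ∑ y, κ x y * ‖M y j‖ := by
      refine (norm_sum_le _ _).trans (Finset.sum_le_sum fun y _ => ?_)
      rw [norm_mul]
      exact mul_le_mul_of_nonneg_right (hent x y) (norm_nonneg _)
    have e2 : (∑ y, κ x y * ‖M y j‖) ^ 2 ≤ (∑ y, κ x y) * ∑ y, κ x y * ‖M y j‖ ^ 2 :=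
      Finset.sum_sq_le_sum_mul_sum_of_sq_le_mul _ (fun y _ => hκ0 x y)
        (fun y _ => mul_nonneg (hκ0 x y) (sq_nonneg _)) (fun y _ => le_of_eq (by ring))
    refine (pow_le_pow_left₀ (norm_nonneg _) e1 2).trans (e2.trans ?_)
    exact mul_le_mul_of_nonneg_right (hκs x)
      (Finset.sum_nonneg fun y _ => mul_nonneg (hκ0 x y) (sq_nonneg _))
  have hws : ∑ x, ‖w x‖ ^ 2 ≤ (K * G) * ((K * G) * c ^ 2) := by
    refine (Finset.sum_le_sum fun x _ => hwx x).trans ?_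
    rw [← Finset.mul_sum, Finset.sum_comm]
    refine mul_le_mul_of_nonneg_left ?_ (by positivity)
    calc ∑ y, ∑ x, κ x y * ‖M y j‖ ^ 2 = ∑ y, (∑ x, κ x y) * ‖M y j‖ ^ 2 := by
          simp only [Finset.sum_mul]
      _ ≤ ∑ y, (K * G) * ‖M y j‖ ^ 2 :=
          Finset.sum_le_sum fun y _ => mul_le_mul_of_nonneg_right (hκs' y) (sq_nonneg _)
      _ ≤ _ := by
          rw [← Finset.mul_sum]
          exact mul_le_mul_of_nonneg_left hu (by positivity)
  have hfu : ∑ x, ‖(f x : ℂ) * M x j‖ ^ 2 ≤ c ^ 2 * ((K * G) * ((K * G) * c ^ 2)) := by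
    have := mulVec_bound M c hM w
    rw [hid] at this
    exact this.trans (mul_le_mul_of_nonneg_left hws (sq_nonneg _))
  have hpt : ∀ x, ‖M x j‖ ≤ (1 + (cdist j x : ℝ)) ^ (-(2 * τ))
      + (2 * ‖M x j‖ ^ 2 + 2 * ‖(f x : ℂ) * M x j‖ ^ 2) := by
    intro x
    have hf0 : 0 ≤ f x := by simp only [hf]; positivity
    rw [norm_mul, Complex.norm_real, Real.norm_of_nonneg hf0]
    set D : ℝ := (cdist x j : ℝ) with hD
    have hD0 : 0 ≤ D := by positivity
    rw [cdist_symm' j x, ← hD]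
    have e1 : (1 + D) ^ τ ≤ 1 + f x := by
      have := Real.rpow_add_le_add_rpow (zero_le_one) hD0 (by linarith : 0 ≤ τ) hτ2
      rwa [Real.one_rpow] at this
    set g := (1 + D) ^ τ with hg
    have hg0 : 0 < g := by positivity
    have e2 : (1 + D) ^ (-(2 * τ)) = (g⁻¹) ^ 2 := by
      rw [Real.rpow_neg (by linarith), mul_comm, Real.rpow_mul (by linarith), inv_pow]
      norm_cast
    rw [e2]
    set m := ‖M x j‖ with hm
    have hm0 : 0 ≤ m := norm_nonneg _
    have e3 : m = g⁻¹ * (g * m) := by field_simp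
    have e4 : g⁻¹ * (g * m) ≤ (g⁻¹) ^ 2 + (g * m) ^ 2 := by
      nlinarith [sq_nonneg (g⁻¹ - g * m), sq_nonneg (g⁻¹), sq_nonneg (g * m)]
    have e5 : (g * m) ^ 2 ≤ ((1 + f x) * m) ^ 2 :=
      pow_le_pow_left₀ (by positivity) (mul_le_mul_of_nonneg_right e1 hm0) 2
    nlinarith [sq_nonneg (m - f x * m)]
  calc ∑ x, ‖M x j‖ ≤ ∑ x, ((1 + (cdist j x : ℝ)) ^ (-(2 * τ))
      + (2 * ‖M x j‖ ^ 2 + 2 * ‖(f x : ℂ) * M x j‖ ^ 2)) := Finset.sum_le_sum fun x _ => hpt x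
    _ = ∑ x, (1 + (cdist j x : ℝ)) ^ (-(2 * τ))
      + (2 * ∑ x, ‖M x j‖ ^ 2 + 2 * ∑ x, ‖(f x : ℂ) * M x j‖ ^ 2) := by
        rw [Finset.sum_add_distrib, Finset.sum_add_distrib, Finset.mul_sum, Finset.mul_sum]
    _ ≤ _ := by
        have := hGs' N j
        linarith

theorem step_two (c K R α : ℝ) (hc : 0 ≤ c) (hK : 0 ≤ K) (hR : 0 ≤ R) (hα : 2 < α) :
    ∃ C : ℝ, 0 ≤ C ∧ ∀ (N : ℕ) (M A : Matrix (Fin N) (Fin N) ℂ), M * A = 1 →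
      (∀ x y, ‖M x y‖ ≤ c) →
      (∀ x y, x ≠ y → ‖A x y‖ ≤ K * (1 + (cdist x y : ℝ)) ^ (-α)) →
      (∀ j, ∑ x, ‖M x j‖ ≤ R) → (∀ x, ∑ j, ‖M x j‖ ≤ R) →
      ∀ x j, ‖M x j‖ * (1 + (cdist x j : ℝ)) ^ α ≤ C := by
  obtain ⟨G, hG, hGs⟩ := sum_bound (α - 1) (by linarith)
  set B : ℝ := α * 2 ^ (α - 1) with hB
  have hB0 : 0 ≤ B := by positivity
  set L : ℝ := R * (K * B) with hL
  have hL0 : 0 ≤ L := by positivity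
  set e : ℝ := (2 * (L * G) + 1)⁻¹ with he
  have he0 : 0 < e := by positivity
  set Y : ℝ := (e⁻¹) ^ (α - 1) with hY
  have hY0 : 0 ≤ Y := by positivity
  have hLGe : L * G * e ≤ 1 / 2 := by
    rw [he, ← div_eq_mul_inv, div_le_iff₀ (by positivity)]
    linarith
  refine ⟨2 ^ α * (c + 2 * (L * (G * (Y * c) + R))), by positivity, ?_⟩
  intro N M A hMA hMc hA hcol hrow x₀ j
  set f : Fin N → ℝ := fun x => (cdist x j : ℝ) ^ α with hf
  have hf0 : ∀ x, 0 ≤ f x := fun x => by simp only [hf]; positivity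
  have hfj : f j = 0 := by
    simp only [hf, cdist_self']
    rw [Nat.cast_zero, Real.zero_rpow (by linarith)]
  have hid := comm_id M A hMA j f hfj
  set w : Fin N → ℂ := fun x => ∑ y, A x y * ((f y : ℂ) - f x) * M y j with hw
  obtain ⟨xm, -, hxm⟩ := Finset.exists_max_image Finset.univ (fun x => f x * ‖M x j‖) ⟨j, by simp⟩
  set W : ℝ := f xm * ‖M xm j‖ with hW
  have hW' : ∀ x, f x * ‖M x j‖ ≤ W := fun x => hxm x (Finset.mem_univ _)
  have hW0 : 0 ≤ W := mul_nonneg (hf0 _) (norm_nonneg _)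
  have hent : ∀ x y, ‖A x y * ((f y : ℂ) - f x) * M y j‖ ≤
      K * B * ((1 + (cdist x y : ℝ)) ^ (-(α - 1)) * (e * W + Y * c) + ‖M y j‖) := by
    intro x y
    by_cases hxy : x = y
    · subst hxy
      rw [sub_self, mul_zero, zero_mul, norm_zero]
      positivity
    rw [norm_mul, norm_mul, ← Complex.ofReal_sub, Complex.norm_real, Real.norm_eq_abs]
    set t : ℝ := (cdist x y : ℝ) with ht
    have ht0 : 0 ≤ t := by positivity
    set b : ℝ := (cdist y j : ℝ) with hb
    have hb0 : 0 ≤ b := by positivity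
    set m : ℝ := ‖M y j‖ with hm
    have hm0 : 0 ≤ m := norm_nonneg _
    have e1 : |f y - f x| ≤ B * (t * b ^ (α - 1) + t * t ^ (α - 1)) := by
      rw [abs_sub_comm]
      refine rpow_diff_big α _ _ _ (by linarith) (by positivity) (by positivity) ht0 ?_ ?_
      · have := cdist_tri x y j
        rw [ht]
        exact_mod_cast (by omega : cdist x j ≤ cdist y j + cdist x y)
      · have := cdist_tri y x j
        rw [cdist_symm' y x] at this
        rw [ht]
        exact_mod_cast (by omega : cdist y j ≤ cdist x j + cdist x y)
    have p1 : (1 + t) ^ (-α) * t ≤ (1 + t) ^ (-(α - 1)) := by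
      have := pow_mul_le t 1 α ht0 zero_le_one
      rwa [Real.rpow_one] at this
    have p2 : (1 + t) ^ (-α) * (t * t ^ (α - 1)) ≤ 1 := by
      have h := pow_mul_le t (α - 1) (α - 1) ht0 (by linarith)
      rw [sub_self, neg_zero, Real.rpow_zero] at h
      calc (1 + t) ^ (-α) * (t * t ^ (α - 1)) = ((1 + t) ^ (-α) * t) * t ^ (α - 1) := by ring
        _ ≤ (1 + t) ^ (-(α - 1)) * t ^ (α - 1) := by gcongr
        _ ≤ 1 := h
    have p3 : b ^ (α - 1) * m ≤ e * W + Y * c := by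
      have h1 := young_pow α b e (by linarith) hb0 he0
      have h2 : b ^ α * m ≤ W := hW' y
      have h3 : m ≤ c := hMc y j
      calc b ^ (α - 1) * m ≤ (e * b ^ α + Y) * m := mul_le_mul_of_nonneg_right h1 hm0
        _ = e * (b ^ α * m) + Y * m := by ring
        _ ≤ _ := by gcongr
    calc ‖A x y‖ * |f y - f x| * m
        ≤ (K * (1 + t) ^ (-α)) * (B * (t * b ^ (α - 1) + t * t ^ (α - 1))) * m :=
          mul_le_mul_of_nonneg_right
            (mul_le_mul (hA x y hxy) e1 (abs_nonneg _) (by positivity)) hm0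
      _ = K * B * (((1 + t) ^ (-α) * t) * (b ^ (α - 1) * m)
          + ((1 + t) ^ (-α) * (t * t ^ (α - 1))) * m) := by ring
      _ ≤ K * B * ((1 + t) ^ (-(α - 1)) * (e * W + Y * c) + 1 * m) := by gcongr
      _ = _ := by rw [one_mul]
  have hwx : ∀ x, ‖w x‖ ≤ K * B * (G * (e * W + Y * c) + R) := by
    intro x
    refine (norm_sum_le _ _).trans ((Finset.sum_le_sum fun y _ => hent x y).trans ?_)
    rw [← Finset.mul_sum, Finset.sum_add_distrib, ← Finset.sum_mul]
    have h1 := hGs N x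
    have h2 := hcol j
    gcongr
  have hWle : W ≤ R * (K * B * (G * (e * W + Y * c) + R)) := by
    have h1 := congrFun hid xm
    have h2 : ‖(f xm : ℂ) * M xm j‖ = W := by
      rw [norm_mul, Complex.norm_real, Real.norm_of_nonneg (hf0 _)]
    have h3 : W = ‖∑ y, M xm y * w y‖ := by rw [← h2, ← h1]; rfl
    refine h3.le.trans ((norm_sum_le _ _).trans ?_)
    calc ∑ y, ‖M xm y * w y‖ ≤ ∑ y, ‖M xm y‖ * (K * B * (G * (e * W + Y * c) + R)) := by
          refine Finset.sum_le_sum fun y _ => ?_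
          rw [norm_mul]
          exact mul_le_mul_of_nonneg_left (hwx y) (norm_nonneg _)
      _ ≤ _ := by
          rw [← Finset.sum_mul]
          exact mul_le_mul_of_nonneg_right (hrow xm) (by positivity)
  have hWb : W ≤ 2 * (L * (G * (Y * c) + R)) := by
    have h1 : R * (K * B * (G * (e * W + Y * c) + R)) =
        (L * G * e) * W + L * (G * (Y * c) + R) := by rw [hL]; ring
    have h2 : (L * G * e) * W ≤ 1 / 2 * W := mul_le_mul_of_nonneg_right hLGe hW0
    linarith
  have hfin : (1 + (cdist x₀ j : ℝ)) ^ α ≤ 2 ^ α * (1 + f x₀) := by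
    set D : ℝ := (cdist x₀ j : ℝ) with hD
    have hD0 : 0 ≤ D := by positivity
    have hfx : f x₀ = D ^ α := rfl
    calc (1 + D) ^ α ≤ (2 * max 1 D) ^ α := by
          apply Real.rpow_le_rpow (by positivity) _ (by linarith)
          have := le_max_left 1 D
          have := le_max_right 1 D
          linarith
      _ = 2 ^ α * (max 1 D) ^ α := Real.mul_rpow (by norm_num) (le_max_of_le_left zero_le_one)
      _ ≤ _ := by
          gcongr
          rw [hfx]
          have : 0 ≤ D ^ α := by positivity
          rcases max_cases 1 D with ⟨h, -⟩ | ⟨h, -⟩ <;> rw [h]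
          · rw [Real.one_rpow]; linarith
          · linarith
  calc ‖M x₀ j‖ * (1 + (cdist x₀ j : ℝ)) ^ α ≤ ‖M x₀ j‖ * (2 ^ α * (1 + f x₀)) := by gcongr
    _ = 2 ^ α * (‖M x₀ j‖ + f x₀ * ‖M x₀ j‖) := by ring
    _ ≤ _ := by
        have h1 := hMc x₀ j
        have h2 := (hW' x₀).trans hWb
        gcongr

/-- A bounded, boundedly invertible solution `M` of the self-consistent
equation `M(−zI − S(M)) = I` has entries decaying at rate `α` with a uniform constant. -/
theorem decay_of_solution (d α c₁ c : ℝ) (hd : 2 < d) (hα : 2 < α) (hαd : α < d)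
    (hc₁ : 0 < c₁) (hc : 0 < c) :
    ∃ C : ℝ, ∀ (N : ℕ) (ξ : Fin N → Fin N → Fin N → Fin N → ℝ),
      (∀ p a b q : Fin N, |ξ p a b q| ≤
        c₁ ^ 2 * max (((cdist p b : ℝ) + (cdist a q : ℝ) + 1) ^ (-d))
          (((cdist p q : ℝ) + (cdist a b : ℝ) + 1) ^ (-d))) →
      (∀ p a b q : Fin N, |ξ p a b q| ≤ c₁ ^ 2 * (1 + (cdist p q : ℝ)) ^ (-d)) →
      ∀ (z : ℂ) (M : Matrix (Fin N) (Fin N) ℂ),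
        IsUnit M →
        M * (-(z • (1 : Matrix (Fin N) (Fin N) ℂ)) - SmapXi ξ M) = 1 →
        l2OpNorm M ≤ c → l2OpNorm M⁻¹ ≤ c →
        normDecayCirc α M ≤ C := by
  obtain ⟨ε, hε0, hε1⟩ : ∃ ε : ℝ, 0 < ε ∧ 2 + 4 * ε ≤ d := ⟨(d - 2) / 4, by linarith, by linarith⟩
  obtain ⟨G, hG, hGs⟩ := sum_bound (2 * (1 / 2 + ε)) (by linarith)
  obtain ⟨C₁, hC₁, hS₁⟩ := S_decay d (1 / 2 + ε) ε c₁ (G + c ^ 2) (by linarith) hε0 (by linarith)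
    (by positivity)
  obtain ⟨R, hR, hR'⟩ := step_one c C₁ (d - (1 / 2 + ε) - ε) hC₁ (by linarith)
  obtain ⟨C₂, hC₂, hS₂⟩ := S_decay d 0 (d - α) c₁ R le_rfl (by linarith) (by linarith) hR
  obtain ⟨C, hC, hfin⟩ := step_two c C₂ R α hc.le hC₂ hR hα
  refine ⟨C, ?_⟩
  intro N ξ h1 h2 z M _ hM hn _
  set A : Matrix (Fin N) (Fin N) ℂ := -(z • (1 : Matrix (Fin N) (Fin N) ℂ)) - SmapXi ξ M with hA
  have hAM : A * M = 1 := mul_eq_one_comm.1 hM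
  have hAS : ∀ x y, x ≠ y → ‖A x y‖ = ‖SmapXi ξ M x y‖ := by
    intro x y hxy
    simp [hA, Matrix.one_apply_ne hxy]
  have hent : ∀ x y, ‖M x y‖ ≤ c := by
    intro x y
    have := (Finset.single_le_sum (f := fun x => ‖M x y‖ ^ 2) (fun i _ => sq_nonneg _)
      (Finset.mem_univ x)).trans (col_bound M c hn y)
    exact le_of_sq_le_sq this hc.le
  have hH : ∀ q b, ∑ a, (1 + (cdist a q : ℝ)) ^ (-(1 / 2 + ε)) * ‖M a b‖ ≤ G + c ^ 2 := by
    intro q b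
    have hg := hGs N q
    have hcb := col_bound M c hn b
    refine le_trans ?_ (add_le_add hg hcb)
    rw [← Finset.sum_add_distrib]
    refine Finset.sum_le_sum fun a _ => ?_
    rw [cdist_symm' q a]
    have hD0 : (0 : ℝ) ≤ 1 + (cdist a q : ℝ) := by positivity
    have e2 : (1 + (cdist a q : ℝ)) ^ (-(2 * (1 / 2 + ε)))
        = ((1 + (cdist a q : ℝ)) ^ (-(1 / 2 + ε))) ^ 2 := by
      rw [show -(2 * (1 / 2 + ε)) = -(1 / 2 + ε) * ((2 : ℕ) : ℝ) by push_cast; ring,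
        Real.rpow_mul hD0, Real.rpow_natCast]
    rw [e2]
    nlinarith [sq_nonneg ((1 + (cdist a q : ℝ)) ^ (-(1 / 2 + ε)) - ‖M a b‖),
      sq_nonneg ((1 + (cdist a q : ℝ)) ^ (-(1 / 2 + ε))), sq_nonneg ‖M a b‖]
  have hA₁ : ∀ x y, x ≠ y →
      ‖A x y‖ ≤ C₁ * (1 + (cdist x y : ℝ)) ^ (-(d - (1 / 2 + ε) - ε)) := by
    intro x y hxy
    rw [hAS x y hxy]
    exact hS₁ N ξ h1 h2 M hH x y
  have hcol : ∀ j, ∑ x, ‖M x j‖ ≤ R := hR' N M A hM hn hA₁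
  have hrow : ∀ x, ∑ j, ‖M x j‖ ≤ R := by
    intro x
    have := hR' N M.conjTranspose A.conjTranspose
      (by rw [← Matrix.conjTranspose_mul, hAM, Matrix.conjTranspose_one])
      (by rw [l2_conj]; exact hn)
      (by
        intro x y hxy
        rw [Matrix.conjTranspose_apply, norm_star, cdist_symm' x y]
        exact hA₁ y x hxy.symm) x
    simpa only [Matrix.conjTranspose_apply, norm_star] using this
  have hA₂ : ∀ x y, x ≠ y → ‖A x y‖ ≤ C₂ * (1 + (cdist x y : ℝ)) ^ (-α) := by
    intro x y hxy
    rw [hAS x y hxy]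
    have := hS₂ N ξ h1 h2 M (by
      intro q b
      simpa using hcol b) x y
    rwa [show d - 0 - (d - α) = α by ring] at this
  have := hfin N M A hM hent hA₂ hcol hrow
  unfold normDecayCirc
  rw [Finset.fold_max_le]
  exact ⟨hC, fun p _ => this p.1 p.2⟩
end
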